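/- Let A be a linear hyperplane arrangement in a subspace of ℝ^d. Then the characteristic polynomial of the fan Fan(A) defined via spherical intrinsic volumes equals the unsigned characteristic polynomial of A: χ̄_{Fan(A)}(t) = χ̄_A(t); equivalently, v_k(Fan(A)) = w_k(A) for all 0 ≤ k ≤ d (the theorem of Klivans–Swartz). -/

import Mathlib

open scoped Pointwise
open MeasureTheory RealInnerProductSpace

noncomputable section

/-- Euclidean space `ℝ^d`. -/
abbrev Ed (d : ℕ) : Type := EuclideanSpace ℝ (Fin d)

/-- A polyhedral cone in `ℝ^d`: a (nonempty) finite intersection of closed linear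
halfspaces; it automatically contains the origin. -/
def IsPolyCone (d : ℕ) (C : Set (Ed d)) : Prop :=
  ∃ s : Finset (Ed d), C = {x | ∀ c ∈ s, ⟪c, x⟫ ≤ 0}

/-- A face of a cone `C`: the intersection of `C` with a supporting linear hyperplane
(`C` itself being a face, for `c = 0`). -/
def IsFaceOf (d : ℕ) (C F : Set (Ed d)) : Prop :=
  ∃ c : Ed d, (∀ x ∈ C, ⟪c, x⟫ ≤ 0) ∧ F = {x ∈ C | ⟪c, x⟫ = 0}

/-- Dimension of a subset of `ℝ^d` (dimension of its linear span). -/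
def setDim (d : ℕ) (S : Set (Ed d)) : ℕ :=
  Module.finrank ℝ (Submodule.span ℝ S)

/-- Dimension of the lineality space of a cone `C`, i.e. of the maximal linear
subspace `C ∩ (-C)` contained in `C`. -/
def linealDim (d : ℕ) (C : Set (Ed d)) : ℕ :=
  setDim d (C ∩ (-C))

/-- A fan: a finite collection of polyhedral cones, pairwise meeting in common faces,
and all having the same linear span. -/
def IsFan (d : ℕ) (N : Set (Set (Ed d))) : Prop :=
  N.Finite ∧ (∀ C ∈ N, IsPolyCone d C) ∧
    (∀ C ∈ N, ∀ C' ∈ N, IsFaceOf d C (C ∩ C') ∧ IsFaceOf d C' (C ∩ C')) ∧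
    (∀ C ∈ N, ∀ C' ∈ N, Submodule.span ℝ C = Submodule.span ℝ C')

/-- The restriction `N ∩ S` of a fan to a set `S`. -/
def fanInter (d : ℕ) (N : Set (Set (Ed d))) (S : Set (Ed d)) : Set (Set (Ed d)) :=
  {D | ∃ C ∈ N, (intrinsicInterior ℝ C ∩ S).Nonempty ∧ D = C ∩ S}

/-- A fan valuation: `φ ∅ = 0` and `φ(N) = φ(N ∩ H^≤) + φ(N ∩ H^≥) - φ(N ∩ H)`
for every fan `N` and every linear hyperplane `H` of `lin N` (encoded by a nonzero
normal vector `c ∈ lin N`). -/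
def IsFanValuation (d : ℕ) {G : Type*} [AddCommGroup G] (φ : Set (Set (Ed d)) → G) : Prop :=
  φ ∅ = 0 ∧
    ∀ N : Set (Set (Ed d)), IsFan d N →
      ∀ c : Ed d, c ≠ 0 → (∀ C ∈ N, c ∈ Submodule.span ℝ C) →
        φ N = φ (fanInter d N {x | ⟪c, x⟫ ≤ 0}) + φ (fanInter d N {x | 0 ≤ ⟪c, x⟫})
              - φ (fanInter d N {x | ⟪c, x⟫ = 0})

/-- A rotation of `ℝ^d`: a linear isometry of determinant `1`. -/
def IsRotation (d : ℕ) (g : Ed d ≃ₗᵢ[ℝ] Ed d) : Prop :=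
  LinearMap.det (g.toLinearEquiv : Ed d →ₗ[ℝ] Ed d) = 1

/-- The image fan `g · N`. -/
def fanMap (d : ℕ) (g : Ed d ≃ₗᵢ[ℝ] Ed d) (N : Set (Set (Ed d))) : Set (Set (Ed d)) :=
  (fun C => g '' C) '' N

/-- `H` is a linear hyperplane of the subspace `L`. -/
def IsHyperplaneOf (d : ℕ) (H L : Submodule ℝ (Ed d)) : Prop :=
  H ≤ L ∧ Module.finrank ℝ H + 1 = Module.finrank ℝ L

/-- (The data of) a hyperplane arrangement: an ambient subspace together with a finite
set of subspaces (intended: hyperplanes of the ambient space). -/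
structure Arrangement (d : ℕ) where
  space : Submodule ℝ (Ed d)
  hyps : Finset (Submodule ℝ (Ed d))

variable {d : ℕ}

/-- The data are an actual arrangement: each member is a hyperplane of the ambient
subspace. -/
def Arrangement.IsArrangement (A : Arrangement d) : Prop :=
  ∀ H ∈ A.hyps, IsHyperplaneOf d H A.space

/-- A `k`-singleton: an arrangement consisting of a single hyperplane of a
`k`-dimensional subspace. -/
def Arrangement.IsSingletonArr (A : Arrangement d) (k : ℕ) : Prop :=
  A.IsArrangement ∧ A.hyps.card = 1 ∧ Module.finrank ℝ A.space = k

/-- The complement `L \ ∪ A` of an arrangement in its ambient subspace. -/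
def arrComplement (A : Arrangement d) : Set (Ed d) :=
  (A.space : Set (Ed d)) \ ⋃ H ∈ A.hyps, (H : Set (Ed d))

/-- The fan of an arrangement: closures of the connected components of the complement. -/
def arrFan (A : Arrangement d) : Set (Set (Ed d)) :=
  {C | ∃ x ∈ arrComplement A, C = closure (connectedComponentIn (arrComplement A) x)}

/-- Deletion `A ∖ H`. -/
def Arrangement.delete (A : Arrangement d) (H : Submodule ℝ (Ed d)) : Arrangement d :=
  letI := Classical.decEq (Submodule ℝ (Ed d))
  ⟨A.space, A.hyps.erase H⟩

/-- Restriction `A / H`. -/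
def Arrangement.restrict (A : Arrangement d) (H : Submodule ℝ (Ed d)) : Arrangement d :=
  letI := Classical.decEq (Submodule ℝ (Ed d))
  ⟨H, (A.hyps.erase H).image (fun H' => H' ⊓ H)⟩

open Polynomial in
/-- The recursive definition of the unsigned characteristic polynomial:
`χ̄_A(t) = t^k + t^(k-1)` for a `k`-singleton, and
`χ̄_A = χ̄_{A∖H} + χ̄_{A/H}` for `H ∈ A` otherwise.  Its coefficients are the unsigned
Whitney numbers of the first kind. -/
inductive IsCharPoly (d : ℕ) : Arrangement d → Polynomial ℤ → Prop
  | singleton (A : Arrangement d) (k : ℕ) (hk : 1 ≤ k) (hA : A.IsSingletonArr k) :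
      IsCharPoly d A (X ^ k + X ^ (k - 1))
  | deletion_restriction (A : Arrangement d) (H : Submodule ℝ (Ed d)) (hH : H ∈ A.hyps)
      (hcard : 1 < A.hyps.card) (p q : Polynomial ℤ)
      (hp : IsCharPoly d (A.delete H) p) (hq : IsCharPoly d (A.restrict H) q) :
      IsCharPoly d A (p + q)

open Classical in
/-- The metric projection (nearest-point map) of a set `C ⊆ ℝ^d`: the unique nearest
point when it exists (as it does for nonempty closed convex sets). -/
def metricProj (d : ℕ) (C : Set (Ed d)) (x : Ed d) : Ed d :=
  if h : ∃! y, y ∈ C ∧ ∀ z ∈ C, dist x y ≤ dist x z then h.choose else 0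

/-- The normal cone `N_F C` of `C` at a face `F`. -/
def normalCone (d : ℕ) (C F : Set (Ed d)) : Set (Ed d) :=
  {c | ∀ x ∈ C, ∀ y ∈ F, ⟪c, x⟫ ≤ ⟪c, y⟫}

/-- `Π_k(C)`: points `x` whose nearest point of `C` lies in the relative interior of a
`k`-dimensional face of `C`. -/
def Pik (d : ℕ) (C : Set (Ed d)) (k : ℕ) : Set (Ed d) :=
  {x | ∃ F, IsFaceOf d C F ∧ metricProj d C x ∈ intrinsicInterior ℝ F ∧ setDim d F = k}

/-- The `k`-th spherical intrinsic volume of a cone. -/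
def sphIntrinsicVol (d : ℕ) (C : Set (Ed d)) (k : ℕ) : ℝ :=
  (volume (Pik d C k ∩ Metric.closedBall (0 : Ed d) 1)).toReal /
    (volume (Metric.closedBall (0 : Ed d) 1)).toReal

/-- The `k`-th spherical intrinsic volume of a fan. -/
def fanIntrinsicVol (d : ℕ) (N : Set (Set (Ed d))) (k : ℕ) : ℝ :=
  ∑ᶠ C ∈ N, sphIntrinsicVol d C k

/-- The indicator-valued spherical intrinsic volume
`V_k(C) = Σ_F [Π_F(C)]`, the sum over all `k`-dimensional faces `F` of `C` of the
indicator functions of `Π_F(C) = π_C⁻¹(F)`. -/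
def Vk (d : ℕ) (C : Set (Ed d)) (k : ℕ) (x : Ed d) : ℤ :=
  ∑ᶠ F ∈ {F | IsFaceOf d C F ∧ setDim d F = k},
    Set.indicator (metricProj d C ⁻¹' F) (fun _ => (1 : ℤ)) x

/-- The polar cone `C^∨`. -/
def polarCone (d : ℕ) (C : Set (Ed d)) : Set (Ed d) :=
  {c | ∀ x ∈ C, ⟪c, x⟫ ≤ 0}

/-- The lattice of flats of an arrangement: all intersections of subfamilies (the empty
intersection being the ambient space). -/
def flats (A : Arrangement d) : Set (Submodule ℝ (Ed d)) :=
  {L | ∃ S : Finset (Submodule ℝ (Ed d)), S ⊆ A.hyps ∧ L = A.space ⊓ S.inf id}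

/-- `μ` is the Möbius function of the lattice of flats of `A`, ordered by *reverse*
inclusion: `μ(L,L) = 1` and `μ(L,M) = - Σ_{L ≼ Z ≺ M} μ(L,Z)` for `M ⊊ L`. -/
def IsMobiusOf (A : Arrangement d)
    (μ : Submodule ℝ (Ed d) → Submodule ℝ (Ed d) → ℤ) : Prop :=
  (∀ L ∈ flats A, μ L L = 1) ∧
    ∀ L ∈ flats A, ∀ M ∈ flats A, M < L →
      μ L M = -∑ᶠ Z ∈ {Z | Z ∈ flats A ∧ Z ≤ L ∧ M < Z}, μ L Z

/-- A polyhedron: a nonempty finite intersection of closed affine halfspaces. -/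
def IsPolyhedron (d : ℕ) (Q : Set (Ed d)) : Prop :=
  Q.Nonempty ∧ ∃ s : Finset (Ed d × ℝ), Q = {x | ∀ p ∈ s, ⟪p.1, x⟫ ≤ p.2}

/-- A nonempty face of a polyhedron `Q`. -/
def IsFaceOfPolyhedron (d : ℕ) (Q F : Set (Ed d)) : Prop :=
  F.Nonempty ∧ ∃ (c : Ed d) (α : ℝ), (∀ x ∈ Q, ⟪c, x⟫ ≤ α) ∧
    F = {x ∈ Q | ⟪c, x⟫ = α}

/-- Dimension of a subset of `ℝ^d` as dimension of its affine hull. -/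
def polyDim (d : ℕ) (S : Set (Ed d)) : ℕ :=
  Module.finrank ℝ (vectorSpan ℝ S)

/-- The Euler characteristic `ε(Q) = Σ_F (-1)^(dim F)` of a polyhedron. -/
def eulerChar (d : ℕ) (Q : Set (Ed d)) : ℤ :=
  ∑ᶠ F ∈ {F | IsFaceOfPolyhedron d Q F}, (-1 : ℤ) ^ polyDim d F

end

noncomputable section KlivansSwartz

variable {d : ℕ} {ι : Type*}

section MetricProj

variable {C : Set (Ed d)}

lemma metricProj_eq_of_inner_le {x y : Ed d} (hy : y ∈ C)
    (h : ∀ z ∈ C, ⟪x - y, z - y⟫ ≤ 0) : metricProj d C x = y := by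
  have key : ∀ z ∈ C, ‖x - y‖ ^ 2 + ‖y - z‖ ^ 2 ≤ ‖x - z‖ ^ 2 := by
    intro z hz
    have h1 : x - z = (x - y) - (z - y) := by abel
    have h2 := norm_sub_sq_real (x - y) (z - y)
    rw [h1, h2, norm_sub_rev y z]
    linarith [h z hz]
  have hex : ∃! y, y ∈ C ∧ ∀ z ∈ C, dist x y ≤ dist x z := by
    refine ⟨y, ⟨hy, fun z hz => ?_⟩, ?_⟩
    · rw [dist_eq_norm, dist_eq_norm]
      refine le_of_sq_le_sq ?_ (norm_nonneg _)
      linarith [key z hz, sq_nonneg ‖y - z‖]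
    · rintro w ⟨hw, hmin⟩
      have h1 := hmin y hy
      rw [dist_eq_norm, dist_eq_norm] at h1
      have h2 : ‖x - w‖ ^ 2 ≤ ‖x - y‖ ^ 2 := by gcongr
      have h3 : ‖y - w‖ ^ 2 ≤ 0 := by linarith [key w hw]
      have h4 : ‖y - w‖ = 0 := by nlinarith [norm_nonneg (y - w)]
      exact (sub_eq_zero.mp (norm_eq_zero.mp h4)).symm
  have hchoose : metricProj d C x = hex.choose := dif_pos hex
  rw [hchoose]
  refine hex.unique hex.choose_spec.1 ⟨hy, fun z hz => ?_⟩
  rw [dist_eq_norm, dist_eq_norm]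
  refine le_of_sq_le_sq ?_ (norm_nonneg _)
  linarith [key z hz, sq_nonneg ‖y - z‖]

lemma metricProj_spec (hne : C.Nonempty) (hcl : IsClosed C) (hconv : Convex ℝ C) (x : Ed d) :
    metricProj d C x ∈ C ∧
      ∀ z ∈ C, ⟪x - metricProj d C x, z - metricProj d C x⟫ ≤ 0 := by
  obtain ⟨y, hy, hmin⟩ := exists_norm_eq_iInf_of_complete_convex hne hcl.isComplete hconv x
  have hin := (norm_eq_iInf_iff_real_inner_le_zero hconv hy).mp hmin
  rw [metricProj_eq_of_inner_le hy hin]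
  exact ⟨hy, hin⟩

lemma continuous_metricProj (hne : C.Nonempty) (hcl : IsClosed C) (hconv : Convex ℝ C) :
    Continuous (metricProj d C) := by
  refine (LipschitzWith.of_dist_le_mul (K := 1) fun x x' => ?_).continuous
  obtain ⟨hy, h⟩ := metricProj_spec hne hcl hconv x
  obtain ⟨hy', h'⟩ := metricProj_spec hne hcl hconv x'
  set y := metricProj d C x
  set y' := metricProj d C x'
  rw [NNReal.coe_one, one_mul, dist_eq_norm, dist_eq_norm]
  have h1 := h y' hy'
  have h2 := h' y hy
  have h3 : ⟪y - y', y - y'⟫ ≤ ⟪x - x', y - y'⟫ := by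
    simp only [inner_sub_left, inner_sub_right] at h1 h2 ⊢
    linarith
  have h4 := real_inner_le_norm (x - x') (y - y')
  rw [real_inner_self_eq_norm_sq] at h3
  by_contra! hlt
  nlinarith [norm_nonneg (x - x'), norm_nonneg (y - y')]

lemma metricProj_eq_of_subset {C' : Set (Ed d)} (hne : C.Nonempty) (hcl : IsClosed C)
    (hconv : Convex ℝ C) (hsub : C' ⊆ C) {x : Ed d} (hx : metricProj d C x ∈ C') :
    metricProj d C' x = metricProj d C x :=
  metricProj_eq_of_inner_le hx fun z hz => (metricProj_spec hne hcl hconv x).2 z (hsub hz)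

/-- If the nearest point of `C` is strictly on one side of a hyperplane, the nearest point of
the part of `C` on the other side lies on that hyperplane. -/
lemma inner_metricProj_eq_zero (hne : C.Nonempty) (hcl : IsClosed C) (hconv : Convex ℝ C)
    {c x : Ed d} (hpos : 0 < ⟪c, metricProj d C x⟫)
    (hne' : (C ∩ {z | ⟪c, z⟫ ≤ 0}).Nonempty) :
    ⟪c, metricProj d (C ∩ {z | ⟪c, z⟫ ≤ 0}) x⟫ = 0 := by
  have hhalf : IsClosed {z : Ed d | ⟪c, z⟫ ≤ 0} := isClosed_le (by fun_prop) (by fun_prop)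
  have hhconv : Convex ℝ {z : Ed d | ⟪c, z⟫ ≤ 0} := by
    intro u hu v hv a b ha hb _
    simp only [Set.mem_ofPred_eq, inner_add_right, inner_smul_right] at *
    nlinarith
  obtain ⟨hy, h⟩ := metricProj_spec hne hcl hconv x
  obtain ⟨hw, h'⟩ := metricProj_spec hne' (hcl.inter hhalf) (hconv.inter hhconv) x
  set y := metricProj d C x
  set w := metricProj d (C ∩ {z | ⟪c, z⟫ ≤ 0}) x
  refine le_antisymm hw.2 (not_lt.mp fun hlt => ?_)
  set s : ℝ := -⟪c, w⟫ / (⟪c, y⟫ - ⟪c, w⟫) with hs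
  have hden : 0 < ⟪c, y⟫ - ⟪c, w⟫ := by linarith
  have hs0 : 0 < s := div_pos (by linarith) hden
  have hs1 : s ≤ 1 := by rw [hs, div_le_one hden]; linarith
  have hm : (1 - s) • w + s • y ∈ C ∩ {z | ⟪c, z⟫ ≤ 0} := by
    refine ⟨hconv hw.1 hy (by linarith) hs0.le (by ring), ?_⟩
    have : s * (⟪c, y⟫ - ⟪c, w⟫) = -⟪c, w⟫ := div_mul_cancel₀ _ hden.ne'
    simp only [Set.mem_ofPred_eq, inner_add_right, inner_smul_right]
    linarith
  have h1 := h' _ hm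
  have h2 : (1 - s) • w + s • y - w = s • (y - w) := by module
  rw [h2, inner_smul_right] at h1
  have h3 : ⟪x - w, y - w⟫ ≤ 0 := by nlinarith
  have h4 := h w hw.1
  have h5 : ⟪y - w, y - w⟫ ≤ 0 := by
    simp only [inner_sub_left, inner_sub_right] at h3 h4 ⊢
    linarith
  have h6 : y - w = 0 := inner_self_eq_zero.mp (le_antisymm h5 real_inner_self_nonneg)
  rw [sub_eq_zero] at h6
  rw [h6] at hpos
  linarith

end MetricProj

section Regions

/-- The points of `L` lying on none of the hyperplanes with normals `n t`, `t ∈ T`. -/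
def regComplement (L : Submodule ℝ (Ed d)) (T : Finset ι) (n : ι → Ed d) : Set (Ed d) :=
  {x | x ∈ L ∧ ∀ t ∈ T, ⟪n t, x⟫ ≠ 0}

/-- The points of `L` weakly on the same side as `x` of each hyperplane with normal `n t`. -/
def regCone (L : Submodule ℝ (Ed d)) (T : Finset ι) (n : ι → Ed d) (x : Ed d) : Set (Ed d) :=
  {y | y ∈ L ∧ ∀ t ∈ T, 0 ≤ ⟪n t, x⟫ * ⟪n t, y⟫}

/-- The closed regions of the arrangement in `L` with normals `n t`, `t ∈ T`. -/
def regFan (L : Submodule ℝ (Ed d)) (T : Finset ι) (n : ι → Ed d) : Set (Set (Ed d)) :=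
  {C | ∃ x ∈ regComplement L T n, C = regCone L T n x}

open Classical in
/-- The normals among `n t`, `t ∈ T`, orthogonal to `y`. -/
def activeSet (T : Finset ι) (n : ι → Ed d) (y : Ed d) : Finset ι :=
  T.filter fun t => ⟪n t, y⟫ = 0

/-- The subspace of `L` orthogonal to the normals `n t`, `t ∈ S`. -/
def flatOf (L : Submodule ℝ (Ed d)) (S : Finset ι) (n : ι → Ed d) : Submodule ℝ (Ed d) where
  carrier := {z | z ∈ L ∧ ∀ t ∈ S, ⟪n t, z⟫ = 0}
  add_mem' := by
    rintro a b ⟨ha, ha'⟩ ⟨hb, hb'⟩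
    refine ⟨L.add_mem ha hb, fun t ht => ?_⟩
    rw [inner_add_right, ha' t ht, hb' t ht, add_zero]
  zero_mem' := ⟨L.zero_mem, fun t _ => inner_zero_right _⟩
  smul_mem' := by
    rintro r a ⟨ha, ha'⟩
    refine ⟨L.smul_mem r ha, fun t ht => ?_⟩
    rw [inner_smul_right, ha' t ht, mul_zero]

variable {L : Submodule ℝ (Ed d)} {T : Finset ι} {n : ι → Ed d}

lemma mem_activeSet {y : Ed d} {t : ι} : t ∈ activeSet T n y ↔ t ∈ T ∧ ⟪n t, y⟫ = 0 := by
  simp [activeSet]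

lemma mem_flatOf {S : Finset ι} {z : Ed d} :
    z ∈ flatOf L S n ↔ z ∈ L ∧ ∀ t ∈ S, ⟪n t, z⟫ = 0 := Iff.rfl

lemma mem_regCone {x y : Ed d} :
    y ∈ regCone L T n x ↔ y ∈ L ∧ ∀ t ∈ T, 0 ≤ ⟪n t, x⟫ * ⟪n t, y⟫ := Iff.rfl

lemma mem_regCone_self {x : Ed d} (hx : x ∈ regComplement L T n) : x ∈ regCone L T n x :=
  ⟨hx.1, fun _ _ => mul_self_nonneg _⟩

lemma isClosed_regCone (x : Ed d) : IsClosed (regCone L T n x) := by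
  have : regCone L T n x = (L : Set (Ed d)) ∩ ⋂ t ∈ T, {y | 0 ≤ ⟪n t, x⟫ * ⟪n t, y⟫} := by
    ext y
    simp [mem_regCone]
  rw [this]
  exact L.closed_of_finiteDimensional.inter <|
    isClosed_biInter fun t _ => isClosed_le (by fun_prop) (by fun_prop)

lemma convex_regCone (x : Ed d) : Convex ℝ (regCone L T n x) := by
  rintro u ⟨hu, hu'⟩ v ⟨hv, hv'⟩ a b ha hb -
  refine ⟨L.add_mem (L.smul_mem a hu) (L.smul_mem b hv), fun t ht => ?_⟩
  rw [inner_add_right, inner_smul_right, inner_smul_right]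
  nlinarith [mul_nonneg ha (hu' t ht), mul_nonneg hb (hv' t ht)]

lemma zero_mem_regCone (x : Ed d) : (0 : Ed d) ∈ regCone L T n x :=
  ⟨L.zero_mem, fun t _ => by simp⟩

lemma nonempty_regCone (x : Ed d) : (regCone L T n x).Nonempty := ⟨0, zero_mem_regCone x⟩

/-- A region is determined by any of its interior points. -/
lemma regCone_eq_of_mem {x z : Ed d} (hx : x ∈ regComplement L T n)
    (hz : z ∈ regComplement L T n) (hzx : z ∈ regCone L T n x) :
    regCone L T n z = regCone L T n x := by
  have hpos : ∀ t ∈ T, 0 < ⟪n t, x⟫ * ⟪n t, z⟫ := fun t ht =>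
    lt_of_le_of_ne (hzx.2 t ht) (mul_ne_zero (hx.2 t ht) (hz.2 t ht)).symm
  ext y
  refine and_congr_right fun _ => forall₂_congr fun t ht => ?_
  rcases mul_pos_iff.mp (hpos t ht) with ⟨h1, h2⟩ | ⟨h1, h2⟩
  · rw [mul_nonneg_iff_of_pos_left h1, mul_nonneg_iff_of_pos_left h2]
  · constructor <;> intro h <;> nlinarith

/-- Adding a positive multiple of an interior point lands in the interior. -/
lemma add_smul_mem_regComplement {x y z : Ed d} (hx : x ∈ regComplement L T n)
    (hz : z ∈ regComplement L T n) (hzx : z ∈ regCone L T n x) (hy : y ∈ regCone L T n x)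
    {a b : ℝ} (ha : 0 ≤ a) (hb : 0 < b) :
    a • y + b • z ∈ regComplement L T n ∧ a • y + b • z ∈ regCone L T n x := by
  have hmem : a • y + b • z ∈ L := L.add_mem (L.smul_mem a hy.1) (L.smul_mem b hzx.1)
  have hpos : ∀ t ∈ T, 0 < ⟪n t, x⟫ * ⟪n t, a • y + b • z⟫ := by
    intro t ht
    have h1 : 0 < ⟪n t, x⟫ * ⟪n t, z⟫ :=
      lt_of_le_of_ne (hzx.2 t ht) (mul_ne_zero (hx.2 t ht) (hz.2 t ht)).symm
    have h2 := hy.2 t ht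
    rw [inner_add_right, inner_smul_right, inner_smul_right]
    nlinarith [mul_nonneg ha h2, mul_pos hb h1]
  exact ⟨⟨hmem, fun t ht h => by have := hpos t ht; rw [h] at this; simp at this⟩,
    hmem, fun t ht => (hpos t ht).le⟩

/-- Moving a point of a region a little inside `L`, without crossing the hyperplanes through it,
stays in the region. -/
lemma eventually_mem_regCone {x y : Ed d} (hx : x ∈ regComplement L T n)
    (hy : y ∈ regCone L T n x) :
    ∀ᶠ z in nhds y, z ∈ flatOf L (activeSet T n y) n → z ∈ regCone L T n x := by
  have h : ∀ t ∈ T, ∀ᶠ z in nhds y, ⟪n t, y⟫ ≠ 0 → 0 ≤ ⟪n t, x⟫ * ⟪n t, z⟫ := by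
    intro t ht
    by_cases h0 : ⟪n t, y⟫ = 0
    · exact Filter.Eventually.of_forall fun z h => absurd h0 h
    · have hpos : 0 < ⟪n t, x⟫ * ⟪n t, y⟫ :=
        lt_of_le_of_ne (hy.2 t ht) (mul_ne_zero (hx.2 t ht) h0).symm
      have hcont : Continuous fun z : Ed d => ⟪n t, x⟫ * ⟪n t, z⟫ := by fun_prop
      exact (hcont.continuousAt.eventually (lt_mem_nhds hpos)).mono fun z hz _ => le_of_lt hz
  filter_upwards [(Filter.eventually_all_finset T).mpr h] with z hz hflat
  refine ⟨hflat.1, fun t ht => ?_⟩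
  by_cases h0 : ⟪n t, y⟫ = 0
  · rw [hflat.2 t (mem_activeSet.mpr ⟨ht, h0⟩), mul_zero]
  · exact hz t ht h0

lemma eventually_add_smul {p : Ed d → Prop} {y : Ed d} (v : Ed d) (h : ∀ᶠ z in nhds y, p z) :
    ∃ ε : ℝ, 0 < ε ∧ p (y + ε • v) ∧ p (y - ε • v) := by
  have h1 : Filter.Tendsto (fun ε : ℝ => y + ε • v) (nhdsWithin 0 (Set.Ioi 0)) (nhds y) := by
    have : Continuous fun ε : ℝ => y + ε • v := by fun_prop
    simpa using (this.tendsto 0).mono_left nhdsWithin_le_nhds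
  have h2 : Filter.Tendsto (fun ε : ℝ => y - ε • v) (nhdsWithin 0 (Set.Ioi 0)) (nhds y) := by
    have : Continuous fun ε : ℝ => y - ε • v := by fun_prop
    simpa using (this.tendsto 0).mono_left nhdsWithin_le_nhds
  obtain ⟨ε, ⟨ha, hb⟩, hε⟩ :=
    (((h1.eventually h).and (h2.eventually h)).and self_mem_nhdsWithin).exists
  exact ⟨ε, hε, ha, hb⟩

/-- From a relative interior point one can move a little away from any other point. -/
lemma exists_sub_smul_mem_of_mem_intrinsicInterior {F : Set (Ed d)} {y z : Ed d}
    (hy : y ∈ intrinsicInterior ℝ F) (hz : z ∈ F) :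
    ∃ ε : ℝ, 0 < ε ∧ y - ε • (z - y) ∈ F := by
  obtain ⟨y, hint, rfl⟩ := mem_intrinsicInterior.mp hy
  rw [mem_interior_iff_mem_nhds, mem_nhds_induced] at hint
  obtain ⟨u, hu, hsub⟩ := hint
  obtain ⟨ε, hε, -, h⟩ := eventually_add_smul (z - (y : Ed d)) (Filter.eventually_mem_set.mpr hu)
  refine ⟨ε, hε, ?_⟩
  have haff : (y : Ed d) - ε • (z - y) ∈ affineSpan ℝ F := by
    have := AffineMap.lineMap_mem (-ε) y.2 (subset_affineSpan ℝ F hz)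
    rw [AffineMap.lineMap_apply_module'] at this
    convert this using 1
    module
  exact hsub (show (⟨_, haff⟩ : affineSpan ℝ F) ∈ Subtype.val ⁻¹' u from h)

/-- A point of a region determines the span of any face containing it in the relative interior. -/
lemma span_face_eq {x y : Ed d} (hx : x ∈ regComplement L T n) {F : Set (Ed d)}
    (hF : IsFaceOf d (regCone L T n x) F) (hy : y ∈ intrinsicInterior ℝ F) :
    Submodule.span ℝ F = flatOf L (activeSet T n y) n := by
  obtain ⟨c, hc, rfl⟩ := hF
  have hyF := intrinsicInterior_subset hy
  apply le_antisymm
  · refine Submodule.span_le.mpr fun z hz => ⟨hz.1.1, fun t ht => ?_⟩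
    obtain ⟨htT, hty⟩ := mem_activeSet.mp ht
    obtain ⟨ε, hε, hm⟩ := exists_sub_smul_mem_of_mem_intrinsicInterior hy hz
    have h1 := hz.1.2 t htT
    have h2 := hm.1.2 t htT
    rw [inner_sub_right, inner_smul_right, inner_sub_right, hty] at h2
    have h3 : ⟪n t, x⟫ * ⟪n t, z⟫ = 0 := by nlinarith
    exact (mul_eq_zero.mp h3).resolve_left (hx.2 t htT)
  · intro z hz
    have hyflat : y ∈ flatOf L (activeSet T n y) n :=
      ⟨hyF.1.1, fun t ht => (mem_activeSet.mp ht).2⟩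
    obtain ⟨ε, hε, h1, h2⟩ := eventually_add_smul z (eventually_mem_regCone hx hyF.1)
    have hz' := Submodule.smul_mem _ ε hz
    have h1' := h1 (Submodule.add_mem _ hyflat hz')
    have h2' := h2 (Submodule.sub_mem _ hyflat hz')
    have hcz : ⟪c, z⟫ = 0 := by
      have e1 := hc _ h1'
      have e2 := hc _ h2'
      have e3 := hyF.2
      rw [inner_add_right, inner_smul_right, e3] at e1
      rw [inner_sub_right, inner_smul_right, e3] at e2
      nlinarith
    have hmem : y + ε • z ∈ {w | w ∈ regCone L T n x ∧ ⟪c, w⟫ = 0} :=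
      ⟨h1', by rw [inner_add_right, inner_smul_right, hcz, hyF.2]; ring⟩
    have h3 := Submodule.sub_mem _ (Submodule.subset_span (R := ℝ) hmem) (Submodule.subset_span hyF)
    rw [add_sub_cancel_left] at h3
    exact (Submodule.smul_mem_iff _ hε.ne').mp h3

/-- Every point of a region lies in the relative interior of some face. -/
lemma exists_face {x y : Ed d} (hx : x ∈ regComplement L T n) (hy : y ∈ regCone L T n x) :
    ∃ F, IsFaceOf d (regCone L T n x) F ∧ y ∈ intrinsicInterior ℝ F := by
  set c : Ed d := -∑ t ∈ activeSet T n y, ⟪n t, x⟫ • n t with hc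
  have hcz : ∀ z, ⟪c, z⟫ = -∑ t ∈ activeSet T n y, ⟪n t, x⟫ * ⟪n t, z⟫ := by
    intro z
    rw [hc, inner_neg_left, sum_inner]
    simp [real_inner_smul_left]
  have hnn : ∀ z ∈ regCone L T n x, ∀ t ∈ activeSet T n y, 0 ≤ ⟪n t, x⟫ * ⟪n t, z⟫ :=
    fun z hz t ht => hz.2 t (mem_activeSet.mp ht).1
  set F : Set (Ed d) := {z | z ∈ regCone L T n x ∧ ⟪c, z⟫ = 0} with hF
  have hFflat : ∀ z ∈ F, z ∈ flatOf L (activeSet T n y) n := by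
    intro z hz
    refine ⟨hz.1.1, fun t ht => ?_⟩
    have h0 := hz.2
    rw [hcz, neg_eq_zero, Finset.sum_eq_zero_iff_of_nonneg (hnn z hz.1)] at h0
    exact (mul_eq_zero.mp (h0 t ht)).resolve_left (hx.2 t (mem_activeSet.mp ht).1)
  have hflatF : ∀ z ∈ flatOf L (activeSet T n y) n, z ∈ regCone L T n x → z ∈ F := by
    intro z hz hzC
    refine ⟨hzC, ?_⟩
    rw [hcz, Finset.sum_eq_zero (fun t ht => by rw [hz.2 t ht, mul_zero]), neg_zero]
  have hyF : y ∈ F := hflatF y ⟨hy.1, fun t ht => (mem_activeSet.mp ht).2⟩ hy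
  refine ⟨F, ⟨c, fun z hz => ?_, rfl⟩, ?_⟩
  · rw [hcz, neg_nonpos]
    exact Finset.sum_nonneg (hnn z hz)
  · rw [mem_intrinsicInterior]
    refine ⟨⟨y, subset_affineSpan ℝ F hyF⟩, ?_, rfl⟩
    rw [mem_interior_iff_mem_nhds, mem_nhds_induced]
    refine ⟨_, eventually_mem_regCone hx hy, fun z hz => ?_⟩
    have hzflat : (z : Ed d) ∈ flatOf L (activeSet T n y) n := by
      have hle : affineSpan ℝ F ≤ (flatOf L (activeSet T n y) n).toAffineSubspace :=
        affineSpan_le.mpr hFflat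
      exact hle z.2
    exact hflatF _ hzflat (hz hzflat)

lemma mem_Pik_regCone_iff {x : Ed d} (hx : x ∈ regComplement L T n) (k : ℕ) (u : Ed d) :
    u ∈ Pik d (regCone L T n x) k ↔
      Module.finrank ℝ
        (flatOf L (activeSet T n (metricProj d (regCone L T n x) u)) n) = k := by
  constructor
  · rintro ⟨F, hF, hu, hk⟩
    rw [← span_face_eq hx hF hu]
    exact hk
  · intro hk
    obtain ⟨F, hF, hu⟩ := exists_face hx
      (metricProj_spec (nonempty_regCone x) (isClosed_regCone x) (convex_regCone x) u).1
    refine ⟨F, hF, hu, ?_⟩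
    rw [setDim, span_face_eq hx hF hu]
    exact hk

lemma measurableSet_Pik {x : Ed d} (hx : x ∈ regComplement L T n) (k : ℕ) :
    MeasurableSet (Pik d (regCone L T n x) k) := by
  classical
  have hmeas : Measurable (metricProj d (regCone L T n x)) :=
    (continuous_metricProj (nonempty_regCone x) (isClosed_regCone x)
      (convex_regCone x)).measurable
  have hS : ∀ S ∈ T.powerset, MeasurableSet {y : Ed d | activeSet T n y = S} := by
    intro S hS
    have : {y : Ed d | activeSet T n y = S} = ⋂ t ∈ T, {y | ⟪n t, y⟫ = 0 ↔ t ∈ S} := by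
      ext y
      simp only [Set.mem_ofPred_eq, Set.mem_iInter]
      constructor
      · rintro rfl t ht
        simp [mem_activeSet, ht]
      · intro h
        ext t
        rw [mem_activeSet]
        exact ⟨fun ⟨a, b⟩ => (h t a).mp b,
          fun a => ⟨Finset.mem_powerset.mp hS a, (h t (Finset.mem_powerset.mp hS a)).mpr a⟩⟩
    rw [this]
    refine Finset.measurableSet_biInter _ fun t _ => ?_
    have h0 : MeasurableSet {y : Ed d | ⟪n t, y⟫ = 0} :=
      (isClosed_eq (by fun_prop) (by fun_prop)).measurableSet
    by_cases ht : t ∈ S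
    · simpa [ht] using h0
    · simp only [ht, iff_false]
      exact h0.compl
  have : Pik d (regCone L T n x) k = metricProj d (regCone L T n x) ⁻¹'
      ⋃ S ∈ T.powerset.filter fun S => Module.finrank ℝ (flatOf L S n) = k,
        {y | activeSet T n y = S} := by
    ext u
    rw [mem_Pik_regCone_iff hx]
    simp only [Set.mem_preimage, Set.mem_iUnion, Set.mem_ofPred_eq, Finset.mem_filter,
      Finset.mem_powerset, exists_prop]
    constructor
    · intro h
      exact ⟨_, ⟨fun t ht => (mem_activeSet.mp ht).1, h⟩, rfl⟩
    · rintro ⟨S, ⟨-, h⟩, rfl⟩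
      exact h
  rw [this]
  exact hmeas (Finset.measurableSet_biUnion _ fun S hS' => hS S (Finset.mem_filter.mp hS').1)

end Regions

section ArrFan

variable {L : Submodule ℝ (Ed d)} {T : Finset ι} {n : ι → Ed d}

lemma closure_connectedComponentIn_regComplement {x : Ed d} (hx : x ∈ regComplement L T n) :
    closure (connectedComponentIn (regComplement L T n) x) = regCone L T n x := by
  apply subset_antisymm
  · refine closure_minimal (fun z hz => ?_) (isClosed_regCone x)
    refine ⟨(connectedComponentIn_subset _ _ hz).1, fun t ht => ?_⟩
    by_contra! hneg
    have hcont : ContinuousOn (fun w : Ed d => ⟪n t, x⟫ * ⟪n t, w⟫)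
        (connectedComponentIn (regComplement L T n) x) := by fun_prop
    have hsub := isPreconnected_connectedComponentIn.intermediate_value hz
      (mem_connectedComponentIn hx) hcont
    obtain ⟨w, hw, hw0⟩ := hsub ⟨hneg.le, mul_self_nonneg _⟩
    exact mul_ne_zero (hx.2 t ht) ((connectedComponentIn_subset _ _ hw).2 t ht) hw0
  · have hopen : regComplement L T n ∩ regCone L T n x ⊆
        connectedComponentIn (regComplement L T n) x := by
      refine IsPreconnected.subset_connectedComponentIn (Convex.isPreconnected ?_)
        ⟨hx, mem_regCone_self hx⟩ Set.inter_subset_left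
      rintro u ⟨hu, hu'⟩ v ⟨hv, hv'⟩ a b ha hb hab
      rcases hb.eq_or_lt with rfl | hb
      · obtain rfl : a = 1 := by linarith
        simpa using ⟨hu, hu'⟩
      · exact add_smul_mem_regComplement hx hv hv' hu' ha hb
    intro y hy
    have hlim : Filter.Tendsto (fun ε : ℝ => y + ε • x) (nhdsWithin 0 (Set.Ioi 0)) (nhds y) := by
      have : Continuous fun ε : ℝ => y + ε • x := by fun_prop
      simpa using (this.tendsto 0).mono_left nhdsWithin_le_nhds
    refine mem_closure_of_tendsto hlim (Filter.eventually_of_mem self_mem_nhdsWithin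
      fun ε hε => hopen ?_)
    simpa using add_smul_mem_regComplement hx hx (mem_regCone_self hx) hy zero_le_one hε

lemma arrFan_eq_regFan {B : Arrangement d}
    (h : arrComplement B = regComplement B.space T n) : arrFan B = regFan B.space T n := by
  ext C
  simp only [arrFan, regFan, h, Set.mem_ofPred_eq]
  refine exists_congr fun x => and_congr_right fun hx => ?_
  rw [closure_connectedComponentIn_regComplement hx]

lemma finite_regFan : (regFan L T n).Finite := by
  classical
  refine (T.powerset.finite_toSet.image fun S =>
    {y | y ∈ L ∧ ∀ t ∈ T, if t ∈ S then 0 ≤ ⟪n t, y⟫ else ⟪n t, y⟫ ≤ 0}).subset ?_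
  rintro C ⟨x, hx, rfl⟩
  refine ⟨T.filter fun t => 0 < ⟪n t, x⟫,
    Finset.mem_coe.mpr (Finset.mem_powerset.mpr (Finset.filter_subset _ _)), ?_⟩
  ext y
  refine and_congr_right fun _ => forall₂_congr fun t ht => ?_
  rcases (hx.2 t ht).lt_or_gt with h | h
  · simp only [Finset.mem_filter, ht, true_and, h.not_gt, if_false]
    constructor <;> intro <;> nlinarith
  · simp only [Finset.mem_filter, ht, true_and, h, if_true, mul_nonneg_iff_of_pos_left]

end ArrFan

section Valuation

variable {L H : Submodule ℝ (Ed d)} {T : Finset ι} {n : ι → Ed d} {i : ι}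

lemma flatOf_activeSet_insert_of_ne [DecidableEq ι] {y : Ed d} (hy : ⟪n i, y⟫ ≠ 0) :
    flatOf L (activeSet (insert i T) n y) n = flatOf L (activeSet T n y) n := by
  ext z
  simp [mem_flatOf, mem_activeSet, hy]

lemma flatOf_activeSet_insert_of_eq [DecidableEq ι]
    (hH : ∀ z, z ∈ H ↔ z ∈ L ∧ ⟪n i, z⟫ = 0) {y : Ed d}
    (hy : ⟪n i, y⟫ = 0) :
    flatOf L (activeSet (insert i T) n y) n = flatOf H (activeSet T n y) n := by
  ext z
  simp [mem_flatOf, mem_activeSet, hy, hH, and_assoc]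

lemma regCone_insert_of_pos [DecidableEq ι] {x z : Ed d} (hx : x ∈ regComplement L T n)
    (hz : z ∈ regComplement L T n) (hzx : z ∈ regCone L T n x) (hpos : 0 < ⟪n i, z⟫) :
    z ∈ regComplement L (insert i T) n ∧
      regCone L (insert i T) n z = regCone L T n x ∩ {y | 0 ≤ ⟪n i, y⟫} := by
  refine ⟨⟨hz.1, by simpa using ⟨hpos.ne', hz.2⟩⟩, ?_⟩
  rw [← regCone_eq_of_mem hx hz hzx]
  ext y
  simp only [mem_regCone, Finset.forall_mem_insert, mul_nonneg_iff_of_pos_left hpos,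
    Set.mem_inter_iff, Set.mem_ofPred_eq]
  tauto

lemma regCone_insert_of_neg [DecidableEq ι] {x z : Ed d} (hx : x ∈ regComplement L T n)
    (hz : z ∈ regComplement L T n) (hzx : z ∈ regCone L T n x) (hneg : ⟪n i, z⟫ < 0) :
    z ∈ regComplement L (insert i T) n ∧
      regCone L (insert i T) n z = regCone L T n x ∩ {y | ⟪n i, y⟫ ≤ 0} := by
  refine ⟨⟨hz.1, by simpa using ⟨hneg.ne, hz.2⟩⟩, ?_⟩
  rw [← regCone_eq_of_mem hx hz hzx]
  ext y
  have : 0 ≤ ⟪n i, z⟫ * ⟪n i, y⟫ ↔ ⟪n i, y⟫ ≤ 0 := by constructor <;> intro <;> nlinarith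
  simp only [mem_regCone, Finset.forall_mem_insert, this,
    Set.mem_inter_iff, Set.mem_ofPred_eq]
  tauto

lemma regCone_of_eq (hH : ∀ z, z ∈ H ↔ z ∈ L ∧ ⟪n i, z⟫ = 0) {x z : Ed d}
    (hx : x ∈ regComplement L T n) (hz : z ∈ regComplement L T n)
    (hzx : z ∈ regCone L T n x) (h0 : ⟪n i, z⟫ = 0) :
    z ∈ regComplement H T n ∧
      regCone H T n z = regCone L T n x ∩ {y | ⟪n i, y⟫ = 0} := by
  refine ⟨⟨(hH z).mpr ⟨hz.1, h0⟩, hz.2⟩, ?_⟩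
  rw [← regCone_eq_of_mem hx hz hzx]
  ext y
  simp only [mem_regCone, hH, Set.mem_inter_iff, Set.mem_ofPred_eq]
  tauto

/-- The residual of the projection onto a region is orthogonal to the flat of the projection. -/
lemma inner_sub_metricProj_eq_zero {x : Ed d} (hx : x ∈ regComplement L T n) (u : Ed d)
    {m : Ed d} (hm : m ∈ flatOf L (activeSet T n (metricProj d (regCone L T n x) u)) n) :
    ⟪u - metricProj d (regCone L T n x) u, m⟫ = 0 := by
  obtain ⟨hy, h⟩ :=
    metricProj_spec (nonempty_regCone x) (isClosed_regCone x) (convex_regCone x) u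
  set y := metricProj d (regCone L T n x) u
  have hyflat : y ∈ flatOf L (activeSet T n y) n :=
    ⟨hy.1, fun t ht => (mem_activeSet.mp ht).2⟩
  obtain ⟨ε, hε, h1, h2⟩ := eventually_add_smul m (eventually_mem_regCone hx hy)
  have hm' := Submodule.smul_mem _ ε hm
  have e1 := h _ (h1 (Submodule.add_mem _ hyflat hm'))
  have e2 := h _ (h2 (Submodule.sub_mem _ hyflat hm'))
  rw [add_sub_cancel_left, inner_smul_right] at e1
  rw [sub_sub_cancel_left, inner_neg_right, inner_smul_right] at e2
  nlinarith

/-- For almost every `u`, the orthogonal projection of `u` to `M` avoids a given proper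
hyperplane section of `M`. -/
lemma ae_inner_ne_zero_of_sub_orthogonal (M : Submodule ℝ (Ed d)) {c : Ed d}
    (hc : ¬ ∀ m ∈ M, ⟪c, m⟫ = 0) :
    ∀ᵐ u : Ed d, ∀ y ∈ M, (∀ m ∈ M, ⟪u - y, m⟫ = 0) → ⟪c, y⟫ ≠ 0 := by
  set a : Ed d := M.starProjection c with ha
  have haM : a ∈ M := M.starProjection_apply_mem c
  have hac : ∀ m ∈ M, ⟪c - a, m⟫ = 0 := fun m hm =>
    M.starProjection_inner_eq_zero c m hm
  have ha0 : a ≠ 0 := by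
    intro h0
    apply hc
    simpa [h0] using hac
  have hnull : volume (((ℝ ∙ a)ᗮ : Submodule ℝ (Ed d)) : Set (Ed d)) = 0 := by
    refine Measure.addHaar_submodule _ _ fun htop => ha0 ?_
    have : a ∈ ((ℝ ∙ a)ᗮ : Submodule ℝ (Ed d)) := htop ▸ Submodule.mem_top
    rwa [Submodule.mem_orthogonal_singleton_iff_inner_right, inner_self_eq_zero] at this
  filter_upwards [measure_eq_zero_iff_ae_notMem.mp hnull] with u hu y hy hort hcy
  apply hu
  rw [SetLike.mem_coe, Submodule.mem_orthogonal_singleton_iff_inner_right]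
  have h1 := hort a haM
  have h2 := hac y hy
  rw [inner_sub_left] at h1 h2
  rw [real_inner_comm a u] at *
  rw [real_inner_comm a y] at *
  linarith

lemma ae_flatOf_eq {x : Ed d} (hx : x ∈ regComplement L T n)
    (hH : ∀ z, z ∈ H ↔ z ∈ L ∧ ⟪n i, z⟫ = 0) :
    ∀ᵐ u : Ed d, ⟪n i, metricProj d (regCone L T n x) u⟫ = 0 →
      flatOf L (activeSet T n (metricProj d (regCone L T n x) u)) n =
        flatOf H (activeSet T n (metricProj d (regCone L T n x) u)) n := by
  have hall : ∀ S ∈ T.powerset, ∀ᵐ u : Ed d, (¬ ∀ m ∈ flatOf L S n, ⟪n i, m⟫ = 0) →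
      ∀ y ∈ flatOf L S n, (∀ m ∈ flatOf L S n, ⟪u - y, m⟫ = 0) → ⟪n i, y⟫ ≠ 0 := by
    intro S _
    by_cases hS : ∀ m ∈ flatOf L S n, ⟪n i, m⟫ = 0
    · exact Filter.Eventually.of_forall fun u h => absurd hS h
    · exact (ae_inner_ne_zero_of_sub_orthogonal _ hS).mono fun u hu _ => hu
  filter_upwards [(Filter.eventually_all_finset _).mpr hall] with u hu h0
  have hy := (metricProj_spec (nonempty_regCone (L := L) (T := T) (n := n) x)
    (isClosed_regCone x) (convex_regCone x) u).1
  by_cases hM : ∀ m ∈ flatOf L (activeSet T n (metricProj d (regCone L T n x) u)) n,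
      ⟪n i, m⟫ = 0
  · ext z
    rw [mem_flatOf, mem_flatOf, hH]
    exact ⟨fun h => ⟨⟨h.1, hM z h⟩, h.2⟩, fun h => ⟨h.1.1, h.2⟩⟩
  · exact absurd h0 (hu _ (Finset.mem_powerset.mpr fun t ht => (mem_activeSet.mp ht).1) hM _
      ⟨hy.1, fun t ht => (mem_activeSet.mp ht).2⟩
      fun m hm => inner_sub_metricProj_eq_zero hx u hm)

lemma measure_identity_of_ae_indicator {α : Type*} [MeasurableSpace α] {μ : Measure α}
    {A B C D K : Set α} (hA : MeasurableSet A) (hB : MeasurableSet B) (hC : MeasurableSet C)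
    (hD : MeasurableSet D) (hK : μ K ≠ ⊤)
    (h : ∀ᵐ u ∂μ, A.indicator (1 : α → ℝ) u + B.indicator 1 u =
      C.indicator 1 u + D.indicator 1 u) :
    (μ (A ∩ K)).toReal + (μ (B ∩ K)).toReal = (μ (C ∩ K)).toReal + (μ (D ∩ K)).toReal := by
  have : IsFiniteMeasure (μ.restrict K) := ⟨by simpa using hK.lt_top⟩
  have key : ∀ {S : Set α}, MeasurableSet S →
      (μ (S ∩ K)).toReal = ∫ u, S.indicator (1 : α → ℝ) u ∂(μ.restrict K) ∧
        Integrable (S.indicator (1 : α → ℝ)) (μ.restrict K) := by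
    intro S hS
    refine ⟨?_, (integrable_const (1 : ℝ)).indicator hS⟩
    rw [integral_indicator_one hS, measureReal_def, Measure.restrict_apply hS]
  rw [(key hA).1, (key hB).1, (key hC).1, (key hD).1, ← integral_add (key hA).2 (key hB).2,
    ← integral_add (key hC).2 (key hD).2]
  exact integral_congr_ae (ae_restrict_of_ae h)

/-- Spherical intrinsic volumes are valuations: cutting a region by a hyperplane that meets its
interior. -/
lemma sphIntrinsicVol_cut (hH : ∀ z, z ∈ H ↔ z ∈ L ∧ ⟪n i, z⟫ = 0) {x z₀ z₁ z₂ : Ed d}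
    (hx : x ∈ regComplement L T n)
    (hz₀ : z₀ ∈ regComplement L T n) (hz₀x : z₀ ∈ regCone L T n x) (h₀ : ⟪n i, z₀⟫ = 0)
    (hz₁ : z₁ ∈ regComplement L T n) (hz₁x : z₁ ∈ regCone L T n x) (h₁ : 0 < ⟪n i, z₁⟫)
    (hz₂ : z₂ ∈ regComplement L T n) (hz₂x : z₂ ∈ regCone L T n x) (h₂ : ⟪n i, z₂⟫ < 0)
    (k : ℕ) :
    sphIntrinsicVol d (regCone L T n x) k +
        sphIntrinsicVol d (regCone L T n x ∩ {y | ⟪n i, y⟫ = 0}) k =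
      sphIntrinsicVol d (regCone L T n x ∩ {y | 0 ≤ ⟪n i, y⟫}) k +
        sphIntrinsicVol d (regCone L T n x ∩ {y | ⟪n i, y⟫ ≤ 0}) k := by
  classical
  obtain ⟨hr₀, hc₀⟩ := regCone_of_eq hH hx hz₀ hz₀x h₀
  obtain ⟨hr₁, hc₁⟩ := regCone_insert_of_pos hx hz₁ hz₁x h₁
  obtain ⟨hr₂, hc₂⟩ := regCone_insert_of_neg hx hz₂ hz₂x h₂
  have hmem := fun u => mem_Pik_regCone_iff hx k u
  have hmem₀ := fun u => mem_Pik_regCone_iff hr₀ k u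
  have hmem₁ := fun u => mem_Pik_regCone_iff hr₁ k u
  have hmem₂ := fun u => mem_Pik_regCone_iff hr₂ k u
  have hme := measurableSet_Pik hx k
  have hme₀ := measurableSet_Pik hr₀ k
  have hme₁ := measurableSet_Pik hr₁ k
  have hme₂ := measurableSet_Pik hr₂ k
  rw [hc₀] at hmem₀ hme₀
  rw [hc₁] at hmem₁ hme₁
  rw [hc₂] at hmem₂ hme₂
  unfold sphIntrinsicVol
  rw [← add_div, ← add_div]
  congr 1
  refine measure_identity_of_ae_indicator hme hme₀ hme₁ hme₂ measure_closedBall_lt_top.ne ?_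
  have hne := nonempty_regCone (L := L) (T := T) (n := n) x
  have hcl := isClosed_regCone (L := L) (T := T) (n := n) x
  have hcv := convex_regCone (L := L) (T := T) (n := n) x
  have hzero := zero_mem_regCone (L := L) (T := T) (n := n) x
  filter_upwards [ae_flatOf_eq (H := H) (i := i) hx hH] with u hu
  simp only [Set.indicator_apply, hmem, hmem₀, hmem₁, hmem₂, Pi.one_apply]
  have hyC := (metricProj_spec hne hcl hcv u).1
  rcases lt_trichotomy ⟪n i, metricProj d (regCone L T n x) u⟫ 0 with hs | hs | hs
  · have e₂ := metricProj_eq_of_subset hne hcl hcv Set.inter_subset_left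
      (show metricProj d (regCone L T n x) u ∈ regCone L T n x ∩ {y | ⟪n i, y⟫ ≤ 0} from
        ⟨hyC, hs.le⟩)
    have e₁ : ⟪n i, metricProj d (regCone L T n x ∩ {y | 0 ≤ ⟪n i, y⟫}) u⟫ = 0 := by
      have := inner_metricProj_eq_zero (c := -n i) hne hcl hcv (x := u)
        (by rw [inner_neg_left]; linarith) ⟨0, hzero, by simp⟩
      simpa only [inner_neg_left, neg_nonpos, neg_eq_zero] using this
    have hc₁' : IsClosed (regCone L T n x ∩ {y | 0 ≤ ⟪n i, y⟫}) := hc₁ ▸ isClosed_regCone z₁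
    have hv₁' : Convex ℝ (regCone L T n x ∩ {y | 0 ≤ ⟪n i, y⟫}) := hc₁ ▸ convex_regCone z₁
    have hn₁' : (regCone L T n x ∩ {y | 0 ≤ ⟪n i, y⟫}).Nonempty := ⟨0, hzero, by simp⟩
    have hy₁ := (metricProj_spec hn₁' hc₁' hv₁' u).1
    have e₀ := metricProj_eq_of_subset (C' := regCone L T n x ∩ {y | ⟪n i, y⟫ = 0}) hn₁' hc₁' hv₁'
      (Set.inter_subset_inter_right _ fun y (hy : ⟪n i, y⟫ = 0) => hy.ge)
      (show _ ∈ regCone L T n x ∩ {y | ⟪n i, y⟫ = 0} from ⟨hy₁.1, e₁⟩)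
    rw [e₂, e₀, flatOf_activeSet_insert_of_ne hs.ne, flatOf_activeSet_insert_of_eq hH e₁]
    ring
  · have e₀ := metricProj_eq_of_subset hne hcl hcv Set.inter_subset_left
      (show metricProj d (regCone L T n x) u ∈ regCone L T n x ∩ {y | ⟪n i, y⟫ = 0} from
        ⟨hyC, hs⟩)
    have e₁ := metricProj_eq_of_subset hne hcl hcv Set.inter_subset_left
      (show metricProj d (regCone L T n x) u ∈ regCone L T n x ∩ {y | 0 ≤ ⟪n i, y⟫} from
        ⟨hyC, hs.ge⟩)
    have e₂ := metricProj_eq_of_subset hne hcl hcv Set.inter_subset_left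
      (show metricProj d (regCone L T n x) u ∈ regCone L T n x ∩ {y | ⟪n i, y⟫ ≤ 0} from
        ⟨hyC, hs.le⟩)
    rw [e₀, e₁, e₂, flatOf_activeSet_insert_of_eq hH hs, hu hs]
  · have e₁ := metricProj_eq_of_subset hne hcl hcv Set.inter_subset_left
      (show metricProj d (regCone L T n x) u ∈ regCone L T n x ∩ {y | 0 ≤ ⟪n i, y⟫} from
        ⟨hyC, hs.le⟩)
    have e₂ : ⟪n i, metricProj d (regCone L T n x ∩ {y | ⟪n i, y⟫ ≤ 0}) u⟫ = 0 :=
      inner_metricProj_eq_zero hne hcl hcv hs ⟨0, hzero, by simp⟩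
    have hc₂' : IsClosed (regCone L T n x ∩ {y | ⟪n i, y⟫ ≤ 0}) := hc₂ ▸ isClosed_regCone z₂
    have hv₂' : Convex ℝ (regCone L T n x ∩ {y | ⟪n i, y⟫ ≤ 0}) := hc₂ ▸ convex_regCone z₂
    have hn₂' : (regCone L T n x ∩ {y | ⟪n i, y⟫ ≤ 0}).Nonempty := ⟨0, hzero, by simp⟩
    have hy₂ := (metricProj_spec hn₂' hc₂' hv₂' u).1
    have e₀ := metricProj_eq_of_subset (C' := regCone L T n x ∩ {y | ⟪n i, y⟫ = 0}) hn₂' hc₂' hv₂'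
      (Set.inter_subset_inter_right _ fun y (hy : ⟪n i, y⟫ = 0) => hy.le)
      (show _ ∈ regCone L T n x ∩ {y | ⟪n i, y⟫ = 0} from ⟨hy₂.1, e₂⟩)
    rw [e₁, e₀, flatOf_activeSet_insert_of_ne hs.ne', flatOf_activeSet_insert_of_eq hH e₂]

end Valuation

section FanSums

variable {L H : Submodule ℝ (Ed d)} {T : Finset ι} {n : ι → Ed d} {i : ι}

/-- The regions of the fan meeting the set `Q` in their interior. -/
def regFanMeeting (L : Submodule ℝ (Ed d)) (T : Finset ι) (n : ι → Ed d) (Q : Set (Ed d)) :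
    Set (Set (Ed d)) :=
  {C | C ∈ regFan L T n ∧ ∃ z ∈ regComplement L T n, z ∈ C ∧ z ∈ Q}

lemma mem_regFanMeeting_iff {Q : Set (Ed d)} {C : Set (Ed d)} :
    C ∈ regFanMeeting L T n Q ↔
      ∃ z ∈ regComplement L T n, z ∈ Q ∧ C = regCone L T n z := by
  constructor
  · rintro ⟨⟨x, hx, rfl⟩, z, hz, hzx, hzQ⟩
    exact ⟨z, hz, hzQ, (regCone_eq_of_mem hx hz hzx).symm⟩
  · rintro ⟨z, hz, hzQ, rfl⟩
    exact ⟨⟨z, hz, rfl⟩, z, hz, mem_regCone_self hz, hzQ⟩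

/-- A region is determined by its intersection with a set meeting its interior. -/
lemma injOn_inter_regFanMeeting (Q : Set (Ed d)) {Q' : Set (Ed d)} (hQ : Q ⊆ Q') :
    Set.InjOn (fun C => C ∩ Q') (regFanMeeting L T n Q) := by
  intro C hC D hD h
  obtain ⟨z, hz, hzQ, rfl⟩ := mem_regFanMeeting_iff.mp hC
  obtain ⟨⟨w, hw, rfl⟩, -⟩ := hD
  have hzD : z ∈ regCone L T n w := by
    have : z ∈ regCone L T n z ∩ Q' := ⟨mem_regCone_self hz, hQ hzQ⟩
    have h : regCone L T n z ∩ Q' = regCone L T n w ∩ Q' := h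
    exact (h.subset this).1
  exact regCone_eq_of_mem hw hz hzD

lemma finite_regFanMeeting (Q : Set (Ed d)) : (regFanMeeting L T n Q).Finite :=
  finite_regFan.subset fun _ h => h.1

lemma regFan_insert [DecidableEq ι] :
    regFan L (insert i T) n =
      (fun C => C ∩ {y | 0 ≤ ⟪n i, y⟫}) '' regFanMeeting L T n {y | 0 < ⟪n i, y⟫} ∪
        (fun C => C ∩ {y | ⟪n i, y⟫ ≤ 0}) '' regFanMeeting L T n {y | ⟪n i, y⟫ < 0} := by
  ext C
  constructor
  · rintro ⟨x, hx, rfl⟩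
    have hx' : x ∈ regComplement L T n :=
      ⟨hx.1, fun t ht => hx.2 t (Finset.mem_insert_of_mem ht)⟩
    rcases (hx.2 i (Finset.mem_insert_self _ _)).lt_or_gt with h | h
    · right
      exact ⟨_, mem_regFanMeeting_iff.mpr ⟨x, hx', h, rfl⟩,
        (regCone_insert_of_neg hx' hx' (mem_regCone_self hx') h).2.symm⟩
    · left
      exact ⟨_, mem_regFanMeeting_iff.mpr ⟨x, hx', h, rfl⟩,
        (regCone_insert_of_pos hx' hx' (mem_regCone_self hx') h).2.symm⟩
  · rintro (⟨D, hD, rfl⟩ | ⟨D, hD, rfl⟩)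
    · obtain ⟨z, hz, h, rfl⟩ := mem_regFanMeeting_iff.mp hD
      obtain ⟨h1, h2⟩ := regCone_insert_of_pos hz hz (mem_regCone_self hz) h
      exact ⟨z, h1, h2.symm⟩
    · obtain ⟨z, hz, h, rfl⟩ := mem_regFanMeeting_iff.mp hD
      obtain ⟨h1, h2⟩ := regCone_insert_of_neg hz hz (mem_regCone_self hz) h
      exact ⟨z, h1, h2.symm⟩

lemma disjoint_regFan_sides :
    Disjoint
      ((fun C => C ∩ {y | 0 ≤ ⟪n i, y⟫}) '' regFanMeeting L T n {y | 0 < ⟪n i, y⟫})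
      ((fun C => C ∩ {y | ⟪n i, y⟫ ≤ 0}) '' regFanMeeting L T n {y | ⟪n i, y⟫ < 0}) := by
  rw [Set.disjoint_left]
  rintro _ ⟨C, ⟨-, z, -, hzC, hz⟩, rfl⟩ ⟨D, -, h⟩
  have hz' : 0 < ⟪n i, z⟫ := hz
  have : z ∈ C ∩ {y | 0 ≤ ⟪n i, y⟫} := ⟨hzC, hz'.le⟩
  have h : D ∩ {y | ⟪n i, y⟫ ≤ 0} = C ∩ {y | 0 ≤ ⟪n i, y⟫} := h
  exact absurd (h.superset this).2 (not_le.mpr hz')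

/-- The hyperplane meets the interior of a region iff the region has interior points on both
sides. -/
lemma regFanMeeting_inter (hi : ∃ v ∈ L, ⟪n i, v⟫ ≠ 0) :
    regFanMeeting L T n {y | 0 < ⟪n i, y⟫} ∩ regFanMeeting L T n {y | ⟪n i, y⟫ < 0} =
      regFanMeeting L T n {y | ⟪n i, y⟫ = 0} := by
  ext C
  constructor
  · rintro ⟨⟨⟨x, hx, rfl⟩, z, hz, hzx, hzQ⟩, -, w, hw, hwx, hwQ⟩
    have hzQ : 0 < ⟪n i, z⟫ := hzQ
    have hwQ : ⟪n i, w⟫ < 0 := hwQ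
    obtain ⟨h1, h2⟩ := add_smul_mem_regComplement hx hz hzx hwx hzQ.le (neg_pos.mpr hwQ)
    refine ⟨⟨x, hx, rfl⟩, _, h1, h2, ?_⟩
    simp only [Set.mem_ofPred_eq, inner_add_right, inner_smul_right]
    ring
  · rintro ⟨⟨x, hx, rfl⟩, z, hz, hzx, hzQ⟩
    have hzQ : ⟪n i, z⟫ = 0 := hzQ
    obtain ⟨v, hv, hv0⟩ := hi
    have key : ∀ u ∈ L, ∃ ε : ℝ, 0 < ε ∧ z + ε • u ∈ regComplement L T n ∧
        z + ε • u ∈ regCone L T n x := by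
      intro u hu
      have hev : ∀ᶠ y in nhds z, (∀ t ∈ T, ⟪n t, y⟫ ≠ 0) ∧
          (y ∈ flatOf L (activeSet T n z) n → y ∈ regCone L T n x) := by
        refine ((Filter.eventually_all_finset T).mpr fun t ht => ?_).and
          (eventually_mem_regCone hx hzx)
        have hcont : Continuous fun y : Ed d => ⟪n t, y⟫ := by fun_prop
        exact hcont.continuousAt.eventually_ne (hz.2 t ht)
      obtain ⟨ε, hε, ⟨h1, h2⟩, -⟩ := eventually_add_smul u hev
      have hL : z + ε • u ∈ L := L.add_mem hz.1 (L.smul_mem ε hu)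
      refine ⟨ε, hε, ⟨hL, h1⟩, h2 ⟨hL, fun t ht => ?_⟩⟩
      obtain ⟨htT, ht0⟩ := mem_activeSet.mp ht
      exact absurd ht0 (hz.2 t htT)
    obtain ⟨ε, hε, a1, a2⟩ := key (⟪n i, v⟫ • v) (L.smul_mem _ hv)
    obtain ⟨δ, hδ, b1, b2⟩ := key (-(⟪n i, v⟫ • v)) (L.neg_mem (L.smul_mem _ hv))
    have hsq : 0 < ⟪n i, v⟫ * ⟪n i, v⟫ := mul_self_pos.mpr hv0
    refine ⟨⟨⟨x, hx, rfl⟩, _, a1, a2, ?_⟩, ⟨x, hx, rfl⟩, _, b1, b2, ?_⟩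
    · simp only [Set.mem_ofPred_eq, inner_add_right, inner_smul_right, hzQ]
      nlinarith [mul_pos hε hsq]
    · simp only [Set.mem_ofPred_eq, inner_add_right, inner_smul_right, inner_neg_right, hzQ]
      nlinarith [mul_pos hδ hsq]

lemma regFanMeeting_union (hi : ∃ v ∈ L, ⟪n i, v⟫ ≠ 0) :
    regFanMeeting L T n {y | 0 < ⟪n i, y⟫} ∪ regFanMeeting L T n {y | ⟪n i, y⟫ < 0} =
      regFan L T n := by
  ext C
  constructor
  · rintro (h | h) <;> exact h.1
  · rintro ⟨x, hx, rfl⟩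
    rcases lt_trichotomy ⟪n i, x⟫ 0 with h | h | h
    · exact Or.inr (mem_regFanMeeting_iff.mpr ⟨x, hx, h, rfl⟩)
    · have : regCone L T n x ∈ regFanMeeting L T n {y | ⟪n i, y⟫ = 0} :=
        mem_regFanMeeting_iff.mpr ⟨x, hx, h, rfl⟩
      rw [← regFanMeeting_inter hi] at this
      exact Or.inl this.1
    · exact Or.inl (mem_regFanMeeting_iff.mpr ⟨x, hx, h, rfl⟩)

lemma regFan_restrict (hH : ∀ z, z ∈ H ↔ z ∈ L ∧ ⟪n i, z⟫ = 0) :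
    regFan H T n =
      (fun C => C ∩ {y | ⟪n i, y⟫ = 0}) '' regFanMeeting L T n {y | ⟪n i, y⟫ = 0} := by
  ext C
  constructor
  · rintro ⟨x, hx, rfl⟩
    have hx' : x ∈ regComplement L T n := ⟨((hH x).mp hx.1).1, hx.2⟩
    have h := ((hH x).mp hx.1).2
    exact ⟨_, mem_regFanMeeting_iff.mpr ⟨x, hx', h, rfl⟩,
      (regCone_of_eq hH hx' hx' (mem_regCone_self hx') h).2.symm⟩
  · rintro ⟨D, hD, rfl⟩
    obtain ⟨z, hz, h, rfl⟩ := mem_regFanMeeting_iff.mp hD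
    obtain ⟨h1, h2⟩ := regCone_of_eq hH hz hz (mem_regCone_self hz) h
    exact ⟨z, h1, h2.symm⟩

/-- A region without interior points on the negative side lies on the nonnegative side. -/
lemma subset_nonneg_of_notMem {C : Set (Ed d)} (hC : C ∈ regFan L T n)
    (h : C ∉ regFanMeeting L T n {y | ⟪n i, y⟫ < 0}) : C ⊆ {y | 0 ≤ ⟪n i, y⟫} := by
  obtain ⟨x, hx, rfl⟩ := hC
  intro y hy
  by_contra hlt
  replace hlt : ⟪n i, y⟫ < 0 := not_le.mp hlt
  apply h
  have hev : ∀ᶠ z in nhds y, ⟪n i, z⟫ < 0 := by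
    have hcont : Continuous fun z : Ed d => ⟪n i, z⟫ := by fun_prop
    exact hcont.continuousAt.eventually (gt_mem_nhds hlt)
  obtain ⟨ε, hε, h1, -⟩ := eventually_add_smul x hev
  obtain ⟨a, b⟩ := add_smul_mem_regComplement hx hx (mem_regCone_self hx) hy zero_le_one hε
  rw [one_smul] at a b
  exact ⟨⟨x, hx, rfl⟩, _, a, b, h1⟩

/-- A region without interior points on the positive side lies on the nonpositive side. -/
lemma subset_nonpos_of_notMem {C : Set (Ed d)} (hC : C ∈ regFan L T n)
    (h : C ∉ regFanMeeting L T n {y | 0 < ⟪n i, y⟫}) : C ⊆ {y | ⟪n i, y⟫ ≤ 0} := by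
  obtain ⟨x, hx, rfl⟩ := hC
  intro y hy
  by_contra hlt
  replace hlt : 0 < ⟪n i, y⟫ := not_le.mp hlt
  apply h
  have hev : ∀ᶠ z in nhds y, 0 < ⟪n i, z⟫ := by
    have hcont : Continuous fun z : Ed d => ⟪n i, z⟫ := by fun_prop
    exact hcont.continuousAt.eventually (lt_mem_nhds hlt)
  obtain ⟨ε, hε, h1, -⟩ := eventually_add_smul x hev
  obtain ⟨a, b⟩ := add_smul_mem_regComplement hx hx (mem_regCone_self hx) hy zero_le_one hε
  rw [one_smul] at a b
  exact ⟨⟨x, hx, rfl⟩, _, a, b, h1⟩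

/-- Deletion-restriction for the intrinsic volumes of the fan of an arrangement. -/
theorem fanIntrinsicVol_insert [DecidableEq ι] (hH : ∀ z, z ∈ H ↔ z ∈ L ∧ ⟪n i, z⟫ = 0)
    (hi : ∃ v ∈ L, ⟪n i, v⟫ ≠ 0) (k : ℕ) :
    fanIntrinsicVol d (regFan L (insert i T) n) k =
      fanIntrinsicVol d (regFan L T n) k + fanIntrinsicVol d (regFan H T n) k := by
  set P := regFanMeeting L T n {y | 0 < ⟪n i, y⟫} with hP
  set N := regFanMeeting L T n {y | ⟪n i, y⟫ < 0} with hN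
  have hPf : P.Finite := finite_regFanMeeting _
  have hNf : N.Finite := finite_regFanMeeting _
  set v : Set (Ed d) → ℝ := fun C => sphIntrinsicVol d C k with hv
  have hP_uncut : ∑ᶠ C ∈ P \ N, v (C ∩ {y | 0 ≤ ⟪n i, y⟫}) = ∑ᶠ C ∈ P \ N, v C :=
    finsum_mem_congr rfl fun C hC => by
      rw [Set.inter_eq_left.mpr (subset_nonneg_of_notMem hC.1.1 hC.2)]
  have hN_uncut : ∑ᶠ C ∈ N \ P, v (C ∩ {y | ⟪n i, y⟫ ≤ 0}) = ∑ᶠ C ∈ N \ P, v C :=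
    finsum_mem_congr rfl fun C hC => by
      rw [Set.inter_eq_left.mpr (subset_nonpos_of_notMem hC.1.1 hC.2)]
  have hcut : (∑ᶠ C ∈ P ∩ N, v C) + ∑ᶠ C ∈ P ∩ N, v (C ∩ {y | ⟪n i, y⟫ = 0}) =
      (∑ᶠ C ∈ P ∩ N, v (C ∩ {y | 0 ≤ ⟪n i, y⟫})) +
        ∑ᶠ C ∈ P ∩ N, v (C ∩ {y | ⟪n i, y⟫ ≤ 0}) := by
    rw [← finsum_mem_add_distrib (hPf.inter_of_left N),
      ← finsum_mem_add_distrib (hPf.inter_of_left N)]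
    refine finsum_mem_congr rfl fun C hC => ?_
    have hC0 := hC
    rw [hP, hN, regFanMeeting_inter hi] at hC0
    obtain ⟨⟨⟨x, hx, rfl⟩, z₁, hz₁, hz₁x, h₁⟩, -, z₂, hz₂, hz₂x, h₂⟩ := hC
    obtain ⟨-, z₀, hz₀, hz₀x, h₀⟩ := hC0
    exact sphIntrinsicVol_cut hH hx hz₀ hz₀x h₀ hz₁ hz₁x h₁ hz₂ hz₂x h₂ k
  have e1 : fanIntrinsicVol d (regFan L (insert i T) n) k =
      (∑ᶠ C ∈ P, v (C ∩ {y | 0 ≤ ⟪n i, y⟫})) + ∑ᶠ C ∈ N, v (C ∩ {y | ⟪n i, y⟫ ≤ 0}) := by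
    rw [fanIntrinsicVol, regFan_insert,
      finsum_mem_union disjoint_regFan_sides (hPf.image _) (hNf.image _),
      finsum_mem_image (injOn_inter_regFanMeeting (Q' := {y | 0 ≤ ⟪n i, y⟫}) {y | 0 < ⟪n i, y⟫}
        fun y hy => (show 0 < ⟪n i, y⟫ from hy).le),
      finsum_mem_image (injOn_inter_regFanMeeting (Q' := {y | ⟪n i, y⟫ ≤ 0}) {y | ⟪n i, y⟫ < 0}
        fun y hy => (show ⟪n i, y⟫ < 0 from hy).le)]
  have e2 : fanIntrinsicVol d (regFan L T n) k = (∑ᶠ C ∈ P, v C) + ∑ᶠ C ∈ N \ P, v C := by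
    rw [fanIntrinsicVol, ← regFanMeeting_union hi, ← Set.union_sdiff_self,
      finsum_mem_union Set.disjoint_sdiff_right hPf (hNf.subset Set.sdiff_subset)]
  have e3 : fanIntrinsicVol d (regFan H T n) k =
      ∑ᶠ C ∈ P ∩ N, v (C ∩ {y | ⟪n i, y⟫ = 0}) := by
    rw [fanIntrinsicVol, regFan_restrict hH,
      finsum_mem_image (injOn_inter_regFanMeeting {y | ⟪n i, y⟫ = 0} subset_rfl),
      ← regFanMeeting_inter hi]
  rw [e1, e2, e3, ← finsum_mem_inter_add_sdiff N hPf, ← finsum_mem_inter_add_sdiff P hNf,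
    ← finsum_mem_inter_add_sdiff (f := v) N hPf, Set.inter_comm N P, hP_uncut, hN_uncut]
  linarith

lemma fanIntrinsicVol_regFan_empty (k : ℕ) :
    fanIntrinsicVol d (regFan L ∅ n) k = if Module.finrank ℝ L = k then 1 else 0 := by
  have hfan : regFan L ∅ n = {regCone L ∅ n 0} := by
    ext C
    simp only [regFan, Set.mem_singleton_iff, Set.mem_ofPred_eq]
    constructor
    · rintro ⟨x, -, rfl⟩
      ext y
      simp [mem_regCone]
    · rintro rfl
      exact ⟨0, ⟨L.zero_mem, by simp⟩, rfl⟩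
  have hflat : ∀ y, flatOf L (activeSet ∅ n y) n = L := by
    intro y
    ext z
    simp [mem_flatOf, mem_activeSet]
  have hmem : ∀ u, u ∈ Pik d (regCone L ∅ n 0) k ↔ Module.finrank ℝ L = k := fun u => by
    rw [mem_Pik_regCone_iff ⟨L.zero_mem, by simp⟩ k u, hflat]
  rw [fanIntrinsicVol, hfan, finsum_mem_singleton, sphIntrinsicVol]
  have hpos : (volume (Metric.closedBall (0 : Ed d) 1)).toReal ≠ 0 :=
    (ENNReal.toReal_pos (Metric.measure_closedBall_pos _ _ one_pos).ne'
      measure_closedBall_lt_top.ne).ne'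
  split_ifs with h
  · rw [show Pik d (regCone L ∅ n 0) k = Set.univ from
      Set.eq_univ_of_forall fun u => (hmem u).mpr h, Set.univ_inter, div_self hpos]
  · rw [show Pik d (regCone L ∅ n 0) k = ∅ from
      Set.eq_empty_of_forall_notMem fun u hu => h ((hmem u).mp hu)]
    simp

end FanSums

section Arrangements

variable {L H : Submodule ℝ (Ed d)} {A : Arrangement d}

lemma IsHyperplaneOf.exists_normal (h : IsHyperplaneOf d H L) :
    ∃ c : Ed d, ∀ x ∈ L, x ∈ H ↔ ⟪c, x⟫ = 0 := by
  obtain ⟨hle, hdim⟩ := h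
  have hlt : H < L := lt_of_le_of_ne hle fun h => by subst h; omega
  obtain ⟨v, hvL, hvH⟩ := SetLike.exists_of_lt hlt
  have hc : v - H.starProjection v ∈ Hᗮ := H.sub_starProjection_mem_orthogonal v
  set c := v - H.starProjection v with hcdef
  have hcv : ⟪c, v⟫ ≠ 0 := by
    have h0 : ⟪c, v⟫ = ⟪c, c⟫ := by
      conv_rhs => rw [hcdef, inner_sub_right, ← hcdef]
      rw [Submodule.inner_left_of_mem_orthogonal (H.starProjection_apply_mem v) hc, sub_zero]
    rw [h0, inner_self_ne_zero, sub_ne_zero]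
    intro h1
    exact hvH (h1 ▸ H.starProjection_apply_mem v)
  have hlt' : L ⊓ (ℝ ∙ c)ᗮ < L := lt_of_le_of_ne inf_le_left fun h1 =>
    hcv (Submodule.mem_orthogonal_singleton_iff_inner_right.mp (inf_eq_left.mp h1 hvL))
  have hle' : H ≤ L ⊓ (ℝ ∙ c)ᗮ := fun x hx =>
    ⟨hle hx, Submodule.mem_orthogonal_singleton_iff_inner_right.mpr
      (Submodule.inner_left_of_mem_orthogonal hx hc)⟩
  have heq : H = L ⊓ (ℝ ∙ c)ᗮ := Submodule.eq_of_le_of_finrank_le hle' (by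
    have := Submodule.finrank_lt_finrank_of_lt hlt'
    omega)
  refine ⟨c, fun x hx => ?_⟩
  rw [← Submodule.mem_orthogonal_singleton_iff_inner_right]
  conv_lhs => rw [heq]
  exact ⟨fun h => h.2, fun h => ⟨hx, h⟩⟩

lemma IsHyperplaneOf.inf {H' : Submodule ℝ (Ed d)} (h' : IsHyperplaneOf d H' L)
    (h : IsHyperplaneOf d H L) (hne : H' ≠ H) : IsHyperplaneOf d (H' ⊓ H) H := by
  obtain ⟨hle, hdim⟩ := h
  obtain ⟨hle', hdim'⟩ := h'
  refine ⟨inf_le_right, ?_⟩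
  have hlt : H < H' ⊔ H := lt_of_le_of_ne le_sup_right fun h1 => hne
    (Submodule.eq_of_le_of_finrank_eq (h1 ▸ le_sup_left) (by omega))
  have h1 := Submodule.finrank_lt_finrank_of_lt hlt
  have h2 := Submodule.finrank_mono (sup_le hle' hle)
  have h3 := Submodule.finrank_sup_add_finrank_inf_eq H' H
  omega

lemma Arrangement.mem_hyps_delete {H' : Submodule ℝ (Ed d)} :
    H' ∈ (A.delete H).hyps ↔ H' ≠ H ∧ H' ∈ A.hyps := by
  classical
  simp [Arrangement.delete]

lemma Arrangement.mem_hyps_restrict {K : Submodule ℝ (Ed d)} :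
    K ∈ (A.restrict H).hyps ↔ ∃ H' ∈ A.hyps, H' ≠ H ∧ H' ⊓ H = K := by
  classical
  simp [Arrangement.restrict, and_assoc, and_left_comm]

lemma Arrangement.IsArrangement.delete (hA : A.IsArrangement) (H : Submodule ℝ (Ed d)) :
    (A.delete H).IsArrangement :=
  fun H' hH' => hA H' (Arrangement.mem_hyps_delete.mp hH').2

lemma Arrangement.IsArrangement.restrict (hA : A.IsArrangement) (hH : H ∈ A.hyps) :
    (A.restrict H).IsArrangement := by
  intro K hK
  obtain ⟨H', hH', hne, rfl⟩ := Arrangement.mem_hyps_restrict.mp hK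
  exact (hA H' hH').inf (hA H hH) hne

lemma mem_arrComplement {x : Ed d} :
    x ∈ arrComplement A ↔ x ∈ A.space ∧ ∀ H ∈ A.hyps, x ∉ H := by
  simp [arrComplement]

lemma arrComplement_eq_regComplement {ι : Type*} {T : Finset ι} {n : ι → Ed d}
    (h : ∀ x ∈ A.space, (∀ H ∈ A.hyps, x ∉ H) ↔ ∀ t ∈ T, ⟪n t, x⟫ ≠ 0) :
    arrComplement A = regComplement A.space T n := by
  ext x
  rw [mem_arrComplement]
  exact and_congr_right (h x)

/-- An arrangement presented by normal vectors. -/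
lemma exists_arrFan_eq_regFan [DecidableEq (Submodule ℝ (Ed d))]
    (hA : A.IsArrangement) (hH : H ∈ A.hyps) :
    ∃ (n : Submodule ℝ (Ed d) → Ed d) (T : Finset (Submodule ℝ (Ed d))),
      (∀ z, z ∈ H ↔ z ∈ A.space ∧ ⟪n H, z⟫ = 0) ∧ (∃ v ∈ A.space, ⟪n H, v⟫ ≠ 0) ∧
      (∀ t, t ∈ T ↔ t ≠ H ∧ t ∈ A.hyps) ∧
      arrFan A = regFan A.space (insert H T) n ∧
      arrFan (A.delete H) = regFan A.space T n ∧ arrFan (A.restrict H) = regFan H T n := by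
  have hex : ∀ K : Submodule ℝ (Ed d), ∃ c : Ed d, K ∈ A.hyps →
      ∀ x ∈ A.space, x ∈ K ↔ ⟪c, x⟫ = 0 := by
    intro K
    by_cases hK : K ∈ A.hyps
    · obtain ⟨c, hc⟩ := (hA K hK).exists_normal
      exact ⟨c, fun _ => hc⟩
    · exact ⟨0, fun h => absurd h hK⟩
  choose n hn using hex
  obtain ⟨hle, hdim⟩ := hA H hH
  have hlt : H < A.space := lt_of_le_of_ne hle fun h => by rw [h] at hdim; omega
  obtain ⟨v, hvL, hvH⟩ := SetLike.exists_of_lt hlt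
  refine ⟨n, A.hyps.erase H, fun z => ⟨fun hz => ⟨hle hz, (hn H hH z (hle hz)).mp hz⟩,
    fun hz => (hn H hH z hz.1).mpr hz.2⟩, ⟨v, hvL, fun h => hvH ((hn H hH v hvL).mpr h)⟩,
    fun t => Finset.mem_erase, ?_, ?_, ?_⟩
  · rw [Finset.insert_erase hH]
    exact arrFan_eq_regFan (arrComplement_eq_regComplement fun x hx =>
      forall₂_congr fun K hK => not_congr (hn K hK x hx))
  · refine arrFan_eq_regFan (B := A.delete H) (arrComplement_eq_regComplement fun x hx => ?_)
    simp only [Arrangement.mem_hyps_delete, Finset.mem_erase]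
    exact forall₂_congr fun K hK => not_congr (hn K hK.2 x hx)
  · refine arrFan_eq_regFan (B := A.restrict H) (arrComplement_eq_regComplement fun x hx => ?_)
    have hx : x ∈ H := hx
    constructor
    · intro h K hK h0
      obtain ⟨hne, hK⟩ := Finset.mem_erase.mp hK
      exact h (K ⊓ H) (Arrangement.mem_hyps_restrict.mpr ⟨K, hK, hne, rfl⟩)
        ⟨(hn K hK x (hle hx)).mpr h0, hx⟩
    · intro h K hK hxK
      obtain ⟨H', hH', hne, rfl⟩ := Arrangement.mem_hyps_restrict.mp hK
      exact h H' (Finset.mem_erase.mpr ⟨hne, hH'⟩) ((hn H' hH' x (hle hx)).mp hxK.1)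

theorem fanIntrinsicVol_arrFan_eq_add (hA : A.IsArrangement) (hH : H ∈ A.hyps) (k : ℕ) :
    fanIntrinsicVol d (arrFan A) k =
      fanIntrinsicVol d (arrFan (A.delete H)) k + fanIntrinsicVol d (arrFan (A.restrict H)) k := by
  classical
  obtain ⟨n, T, h1, h2, -, h3, h4, h5⟩ := exists_arrFan_eq_regFan hA hH
  rw [h3, h4, h5, fanIntrinsicVol_insert h1 h2 k]

theorem fanIntrinsicVol_arrFan_singleton (hA : A.IsArrangement) (hH : A.hyps = {H}) (k : ℕ) :
    fanIntrinsicVol d (arrFan A) k =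
      (if Module.finrank ℝ A.space = k then 1 else 0) +
        if Module.finrank ℝ H = k then 1 else 0 := by
  classical
  obtain ⟨n, T, h1, h2, hT, h3, -, -⟩ :=
    exists_arrFan_eq_regFan hA (H := H) (by rw [hH]; exact Finset.mem_singleton_self H)
  obtain rfl : T = ∅ := Finset.eq_empty_of_forall_notMem fun t ht => by
    rw [hT, hH, Finset.mem_singleton] at ht
    exact ht.1 ht.2
  rw [h3, fanIntrinsicVol_insert h1 h2 k, fanIntrinsicVol_regFan_empty,
    fanIntrinsicVol_regFan_empty]

theorem IsCharPoly.fanIntrinsicVol_arrFan {p : Polynomial ℤ} (hp : IsCharPoly d A p)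
    (hA : A.IsArrangement) (k : ℕ) :
    fanIntrinsicVol d (arrFan A) k = (p.coeff k : ℝ) := by
  induction hp with
  | singleton A j hj hs =>
    obtain ⟨-, hcard, hrank⟩ := hs
    obtain ⟨H, hH⟩ := Finset.card_eq_one.mp hcard
    obtain ⟨-, hdim⟩ := hA H (by rw [hH]; exact Finset.mem_singleton_self H)
    have hrank' : Module.finrank ℝ H = j - 1 := by omega
    rw [fanIntrinsicVol_arrFan_singleton hA hH, hrank, hrank', Polynomial.coeff_add,
      Polynomial.coeff_X_pow, Polynomial.coeff_X_pow]
    push_cast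
    simp only [eq_comm]
  | deletion_restriction A H hH hcard p q hp hq ihp ihq =>
    rw [fanIntrinsicVol_arrFan_eq_add hA hH, ihp (hA.delete H), ihq (hA.restrict hH),
      Polynomial.coeff_add, Int.cast_add]

end Arrangements

end KlivansSwartz

/-- Klivans--Swartz. The spherical intrinsic volumes of the fan of a
hyperplane arrangement are the unsigned Whitney numbers of the first kind:
`χ̄_{Fan(A)} = χ̄_A`, i.e. `v_k(Fan(A)) = w_k(A)` for all `0 ≤ k ≤ d`. -/
theorem klivans_swartz
    (d : ℕ) (A : Arrangement d) (hA : A.IsArrangement)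
    (p : Polynomial ℤ) (hp : IsCharPoly d A p) :
    ∀ k ≤ d, fanIntrinsicVol d (arrFan A) k = (p.coeff k : ℝ) := by
  exact fun k _ => hp.fanIntrinsicVol_arrFan hA k
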